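/- arXiv:2411.14238 — 2 statements merged into one kernel-verified Lean document; each statement's English description precedes it below -/
import Mathlib

section
/- Let G_1 and G_2 be finite simple unicyclic bipartite graphs on the same number of vertices, whose unique cycles C_1 and C_2 respectively are 4-cycles, and suppose that G_1∖C_1 and G_2∖C_2 are cospectral (det(xI − A(G_1∖C_1)) = det(xI − A(G_2∖C_2))). Then G_1 and G_2 are cospectral (det(xI − A(G_1)) = det(xI − A(G_2))) if and only if they are per-cospectral (per(xI − A(G_1)) = per(xI − A(G_2))). -/
open Polynomial SimpleGraph
open scoped Classical

noncomputable section

/-- The adjacency matrix of a simple graph `G`, with entries in `R`. -/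
def adjMat (R : Type*) [Zero R] [One R] {V : Type*} [Fintype V] (G : SimpleGraph V) :
    Matrix V V R := fun u v => if G.Adj u v then 1 else 0

/-- The characteristic polynomial `det (xI - A(G))` of a simple graph `G`. -/
def charPolyG (R : Type*) [CommRing R] {V : Type*} [Fintype V] (G : SimpleGraph V) : R[X] :=
  (adjMat R G).charpoly

/-- The permanental polynomial `per (xI - A(G))` of a simple graph `G`. -/
def permPolyG (R : Type*) [CommRing R] {V : Type*} [Fintype V] (G : SimpleGraph V) : R[X] :=
  (Matrix.charmatrix (adjMat R G)).permanent

/-- The modified characteristic polynomial `φ_p(G,x) = ∑_{i even} (-1)^{i/2} a_i x^{n-i}`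
of a (bipartite) graph `G` on `n` vertices, where `a_i` is the coefficient of `x^{n-i}`
in the characteristic polynomial. -/
def phiP {V : Type*} [Fintype V] (G : SimpleGraph V) : ℝ[X] :=
  ∑ i ∈ Finset.range (Fintype.card V + 1),
    if Even i then
      C ((-1 : ℝ) ^ (i / 2) * (charPolyG ℝ G).coeff (Fintype.card V - i)) *
        X ^ (Fintype.card V - i)
    else 0

/-- `G` contains no cycle whose length is divisible by 4. -/
def C4kFree {V : Type*} (G : SimpleGraph V) : Prop :=
  ¬ ∃ (v : V) (c : G.Walk v v), c.IsCycle ∧ 4 ∣ c.length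

/-- `G` is `4k`-intercyclic: it contains no two vertex-disjoint cycles,
each of length divisible by 4. -/
def Intercyclic4k {V : Type*} (G : SimpleGraph V) : Prop :=
  ¬ ∃ (u v : V) (c : G.Walk u u) (d : G.Walk v v),
      c.IsCycle ∧ d.IsCycle ∧ 4 ∣ c.length ∧ 4 ∣ d.length ∧
      ∀ x, x ∈ c.support → x ∉ d.support

/-- A subgraph `R` of `G` is a cycle of `G` if it is the subgraph traced by some cycle walk. -/
def IsCycleSubgraph {V : Type*} (G : SimpleGraph V) (R : G.Subgraph) : Prop :=
  ∃ (v : V) (c : G.Walk v v), c.IsCycle ∧ R = c.toSubgraph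

/-- The set of all `4k`-cycles (cycles of length divisible by 4) of `G`,
viewed as subgraphs. -/
def cycles4k {V : Type*} (G : SimpleGraph V) : Set G.Subgraph :=
  {R | ∃ (v : V) (c : G.Walk v v), c.IsCycle ∧ 4 ∣ c.length ∧ R = c.toSubgraph}

/-- The connected component `c` of the subgraph `H` is a single edge (a `K₂`). -/
def IsEdgeComp {V : Type*} {G : SimpleGraph V} (H : G.Subgraph)
    (c : H.coe.ConnectedComponent) : Prop :=
  ∃ x y : H.verts, H.coe.Adj x y ∧ c.supp = {x, y}

/-- The connected component `c` of the subgraph `H` is a cycle: there is a cycle walk whose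
support is exactly `c` and which uses every edge of `H` inside `c`. -/
def IsCycleComp {V : Type*} {G : SimpleGraph V} (H : G.Subgraph)
    (c : H.coe.ConnectedComponent) : Prop :=
  ∃ (v : H.verts) (w : H.coe.Walk v v), w.IsCycle ∧
    {x | x ∈ w.support} = c.supp ∧
    ∀ x y : H.verts, H.coe.Adj x y → x ∈ c.supp → w.toSubgraph.Adj x y

/-- A Sachs subgraph of `G`: a subgraph each of whose connected components is either
a single edge or a cycle. -/
def IsSachs {V : Type*} {G : SimpleGraph V} (H : G.Subgraph) : Prop :=
  ∀ c : H.coe.ConnectedComponent, IsEdgeComp H c ∨ IsCycleComp H c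

/-- The number of connected components of the subgraph `H`. -/
def pCount {V : Type*} {G : SimpleGraph V} (H : G.Subgraph) : ℕ :=
  Nat.card H.coe.ConnectedComponent

/-- The number of components of `H` that are cycles of length divisible by 4. -/
def sCount {V : Type*} {G : SimpleGraph V} (H : G.Subgraph) : ℕ :=
  Set.ncard {c : H.coe.ConnectedComponent | IsCycleComp H c ∧ c.supp.ncard % 4 = 0}

/-- The number of components of `H` that are cycles of length congruent to 2 mod 4. -/
def tCount {V : Type*} {G : SimpleGraph V} (H : G.Subgraph) : ℕ :=
  Set.ncard {c : H.coe.ConnectedComponent | IsCycleComp H c ∧ c.supp.ncard % 4 = 2}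

/-- The number of components of `H` that are cycles. -/
def cycCount {V : Type*} {G : SimpleGraph V} (H : G.Subgraph) : ℕ :=
  Set.ncard {c : H.coe.ConnectedComponent | IsCycleComp H c}

/-- `R` is a union of connected components of `H`. -/
def IsComponentUnion {V : Type*} {G : SimpleGraph V} (R H : G.Subgraph) : Prop :=
  R ≤ H ∧ ∀ x y, H.Adj x y → x ∈ R.verts → R.Adj x y



/-- The walk traced by `n` steps along an orbit of a permutation moving along edges. -/
theorem exists_walk_of_perm {V : Type*} {G : SimpleGraph V} (σ : Equiv.Perm V) (v : V)
    (hσ : ∀ k : ℕ, G.Adj ((σ ^ k) v) ((σ ^ (k + 1)) v)) (n : ℕ) :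
    ∃ p : G.Walk v ((σ ^ n) v),
      p.support = (List.range (n + 1)).map (fun k => (σ ^ k) v) ∧
      ∀ k < n, s((σ ^ k) v, (σ ^ (k + 1)) v) ∈ p.edges := by
  induction n with
  | zero => exact ⟨Walk.nil, by simp; rfl, by simp⟩
  | succ n ih =>
    obtain ⟨p, hp, he⟩ := ih
    refine ⟨p.concat (hσ n), ?_, ?_⟩
    · rw [Walk.support_concat, hp, List.range_succ (n := n + 1)]
      simp
    · intro k hk
      rw [Walk.edges_concat, List.concat_eq_append, List.mem_append, List.mem_singleton]
      rcases Nat.lt_succ_iff_lt_or_eq.mp hk with h | rfl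
      · exact Or.inl (he k h)
      · exact Or.inr rfl

/-- A nontrivial orbit, of length at least three, of a permutation moving along the edges of a
graph traces a cycle. -/
theorem exists_isCycle_of_perm {V : Type*} [Fintype V] {G : SimpleGraph V} (σ : Equiv.Perm V)
    (hσ : ∀ i, σ i ≠ i → G.Adj i (σ i)) (v : V) (hv : σ (σ v) ≠ v) :
    ∃ (u : V) (c : G.Walk u u), c.IsCycle ∧
      ∀ x ∈ c.support, σ (σ x) ≠ x ∧ c.toSubgraph.Adj x (σ x) := by
  have hv1 : σ v ≠ v := fun h => hv (by rw [h, h])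
  have comm : ∀ (k : ℕ) (x : V), (σ ^ (k + 1)) x = σ ((σ ^ k) x) := fun k x => by
    rw [pow_succ', Equiv.Perm.mul_apply]
  have comm' : ∀ (k : ℕ) (x : V), (σ ^ (k + 1)) x = (σ ^ k) (σ x) := fun k x => by
    rw [pow_succ, Equiv.Perm.mul_apply]
  have hadj : ∀ k : ℕ, G.Adj ((σ ^ k) v) ((σ ^ (k + 1)) v) := fun k => by
    rw [comm]
    apply hσ
    rw [← comm, comm']
    exact fun h => hv1 ((σ ^ k).injective h)
  have hit : ∀ k : ℕ, (σ ^ k) v = σ^[k] v := fun k => by rw [Equiv.Perm.iterate_eq_pow]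
  have hper : v ∈ Function.periodicPts σ :=
    Function.mem_periodicPts.mpr ⟨orderOf σ, orderOf_pos σ, by
      rw [Function.IsPeriodicPt, Function.IsFixedPt, ← hit, pow_orderOf_eq_one]; rfl⟩
  set m := Function.minimalPeriod σ v with hm
  have hpos : 0 < m := Function.minimalPeriod_pos_of_mem_periodicPts hper
  have hm0 : σ^[m] v = v := Function.iterate_minimalPeriod
  have hm3 : 3 ≤ m := by
    by_contra! h
    interval_cases m
    · exact hv1 hm0
    · exact hv hm0
  obtain ⟨n, hn⟩ : ∃ n, m = n + 1 := ⟨m - 1, by omega⟩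
  obtain ⟨p, hp, he⟩ := exists_walk_of_perm σ v hadj n
  have hlast : (σ ^ (n + 1)) v = v := by rw [hit, ← hn, hm0]
  have hclose : G.Adj ((σ ^ n) v) v := by simpa only [hlast] using hadj n
  have hnodup : p.IsPath := by
    rw [Walk.isPath_def, hp]
    refine List.Nodup.map_on ?_ List.nodup_range
    intro i hi j hj hij
    rw [List.mem_range] at hi hj
    simp only [hit] at hij
    exact Function.iterate_injOn_Iio_minimalPeriod (f := σ) (x := v)
      (by simpa [← hm, hn] using hi) (by simpa [← hm, hn] using hj) hij
  have hlen : p.length = n := by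
    have := congrArg List.length hp
    simpa using this
  refine ⟨_, Walk.cons hclose p, ?_, ?_⟩
  · rw [Walk.isCycle_iff_isPath_tail_and_le_length]
    refine ⟨by simpa using hnodup, by simp [hlen]; omega⟩
  · intro x hx
    obtain ⟨k, hk, rfl⟩ : ∃ k ≤ n, (σ ^ k) v = x := by
      rw [Walk.support_cons, List.mem_cons, hp] at hx
      rcases hx with rfl | hx
      · exact ⟨n, le_rfl, rfl⟩
      · simpa [Nat.lt_succ_iff] using hx
    refine ⟨?_, ?_⟩
    · rw [← comm, ← comm, comm', comm']
      exact fun h => hv ((σ ^ k).injective h)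
    · rw [Walk.adj_toSubgraph_iff_mem_edges, Walk.edges_cons]
      rcases hk.lt_or_eq with h | rfl
      · rw [← comm]; exact List.mem_cons_of_mem _ (he k h)
      · rw [← comm, hlast]; simp

/-- In a graph whose only cycle is `c` of length four, a permutation moving along edges that is
not an involution maps each vertex of `c` to the next one, in one of the two directions. -/
theorem perm_rotates_of_unique_cycle {V : Type*} [Fintype V] {G : SimpleGraph V} {v : V}
    (c : G.Walk v v) (hc : c.IsCycle) (hl : c.length = 4)
    (huniq : ∀ R : G.Subgraph, IsCycleSubgraph G R → R = c.toSubgraph) :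
    ∃ a b d e : V, [a, b, d, e].Nodup ∧ G.Adj a b ∧ G.Adj b d ∧ G.Adj d e ∧ G.Adj e a ∧
      c.toSubgraph.verts = {a, b, d, e} ∧
      ∀ σ : Equiv.Perm V, (∀ i, σ i ≠ i → G.Adj i (σ i)) → ∀ w, σ (σ w) ≠ w →
        (σ a = b ∧ σ b = d ∧ σ d = e ∧ σ e = a) ∨
          (σ a = e ∧ σ e = d ∧ σ d = b ∧ σ b = a) := by
  match c, hl with
  | .cons (v := b) h₁ (.cons (v := d) h₂ (.cons (v := e) h₃ (.cons h₄ .nil))), _ =>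
    have hne : [v, b, d, e].Nodup := by
      have h := hc.support_nodup
      simp at h ⊢
      grind
    set c := Walk.cons h₁ (.cons h₂ (.cons h₃ (.cons h₄ .nil))) with hcdef
    have hverts : c.toSubgraph.verts = {v, b, d, e} := by
      ext x
      rw [Walk.mem_verts_toSubgraph]
      simp [hcdef]
      grind
    refine ⟨v, b, d, e, hne, h₁, h₂, h₃, h₄, hverts, fun σ hσ w hw => ?_⟩
    obtain ⟨u, p, hp, hpσ⟩ := exists_isCycle_of_perm σ hσ w hw
    have hpc := huniq _ ⟨u, p, hp, rfl⟩
    have key : ∀ x ∈ c.toSubgraph.verts, σ (σ x) ≠ x ∧ c.toSubgraph.Adj x (σ x) := by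
      rw [← hpc]
      intro x hx
      exact hpσ x ((Walk.mem_verts_toSubgraph p).mp hx)
    have hadj : ∀ x y, c.toSubgraph.Adj x y → s(x, y) = s(v, b) ∨ s(x, y) = s(b, d) ∨
        s(x, y) = s(d, e) ∨ s(x, y) = s(e, v) := by
      intro x y h
      rw [Walk.adj_toSubgraph_iff_mem_edges] at h
      simpa [hcdef] using h
    simp only [Sym2.eq_iff] at hadj
    have ka := key v (by rw [hverts]; simp)
    have kb := key b (by rw [hverts]; simp)
    have kd := key d (by rw [hverts]; simp)
    have ke := key e (by rw [hverts]; simp)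
    have ha := hadj _ _ ka.2
    have hb := hadj _ _ kb.2
    have hd := hadj _ _ kd.2
    have he := hadj _ _ ke.2
    replace ka := ka.1
    replace kb := kb.1
    replace kd := kd.1
    replace ke := ke.1
    clear hadj key hpc hpσ hverts huniq hc hσ
    simp at hne
    grind

open Equiv Equiv.Perm in
/-- The part of the Leibniz expansion over permutations agreeing on `s` with a given `r`. -/
theorem sum_perm_agree {V R : Type*} [Fintype V] [CommRing R] (M : Matrix V V R) (s : Set V)
    (r : Perm V) (hr : ∀ i ∉ s, r i = i) :
    ∑ σ : Perm V with ∀ i ∈ s, σ i = r i, ((sign σ : ℤ) : R) * ∏ i, M (σ i) i =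
      ((sign r : ℤ) : R) * (∏ i : s, M (r i) i) *
        (M.submatrix ((↑) : ↑sᶜ → V) (↑)).det := by
  rw [Matrix.det_apply', Finset.mul_sum]
  symm
  refine Finset.sum_bij (fun τ _ => r * ofSubtype τ) ?_ ?_ ?_ ?_
  · intro τ _
    rw [Finset.mem_filter]
    refine ⟨Finset.mem_univ _, fun i hi => ?_⟩
    rw [mul_apply, ofSubtype_apply_of_not_mem τ (by simpa using hi)]
  · intro τ _ τ' _ h
    exact ofSubtype_injective (mul_left_cancel h)
  · intro σ hσ
    have hσ := (Finset.mem_filter.mp hσ).2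
    have hfix : ∀ x, (r⁻¹ * σ) x ≠ x → x ∈ sᶜ := fun x hx hs => hx (by
      rw [mul_apply, hσ x hs]; exact r.symm_apply_apply x)
    have hmaps : ∀ x, (r⁻¹ * σ) x ∈ sᶜ ↔ x ∈ sᶜ := fun x => by
      by_cases h : (r⁻¹ * σ) x = x
      · rw [h]
      · exact iff_of_true (hfix _ fun h' => h ((r⁻¹ * σ).injective h')) (hfix _ h)
    refine ⟨(r⁻¹ * σ).subtypePerm hmaps, Finset.mem_univ _, ?_⟩
    rw [ofSubtype_subtypePerm hmaps hfix, mul_inv_cancel_left]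
  · intro τ _
    rw [Perm.sign_mul, sign_ofSubtype,
      ← Fintype.prod_subtype_mul_prod_subtype (· ∈ s) fun i => M ((r * ofSubtype τ) i) i]
    have h₁ : ∏ i : {x // x ∈ s}, M ((r * ofSubtype τ) i) i = ∏ i : s, M (r i) i := by
      refine Finset.prod_congr rfl fun i _ => ?_
      rw [mul_apply, ofSubtype_apply_of_not_mem τ (by simp)]
    have h₂ : ∏ i : {x // x ∉ s}, M ((r * ofSubtype τ) i) i =
        ∏ i : ↑sᶜ, M.submatrix ((↑) : ↑sᶜ → V) (↑) (τ i) i := by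
      refine Finset.prod_congr rfl fun i _ => ?_
      rw [mul_apply, ofSubtype_apply_coe τ i, hr _ (τ i).2]
      rfl
    rw [h₁, h₂]
    push_cast
    ring

open Equiv Equiv.Perm in
/-- In a graph whose only cycle is `c` of length four, the permutations moving along edges that
are not involutions act on `c` as one of the two rotations of `c`. -/
theorem exists_rotation {V : Type*} [Fintype V] {G : SimpleGraph V} {v : V}
    (c : G.Walk v v) (hc : c.IsCycle) (hl : c.length = 4)
    (huniq : ∀ R : G.Subgraph, IsCycleSubgraph G R → R = c.toSubgraph) :
    ∃ r : Perm V, sign r = -1 ∧ r.support.card = 4 ∧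
      (∀ i, i ∈ c.toSubgraph.verts ↔ i ∈ r.support) ∧
      (∀ i, r i ≠ i → G.Adj i (r i)) ∧ (∀ i ∈ c.toSubgraph.verts, r (r i) ≠ i) ∧
      ∀ σ : Perm V, (∀ i, σ i ≠ i → G.Adj i (σ i)) → σ ^ 2 ≠ 1 →
        (∀ i ∈ c.toSubgraph.verts, σ i = r i) ∨ (∀ i ∈ c.toSubgraph.verts, σ i = r⁻¹ i) := by
  obtain ⟨a, b, d, e, hne, h₁, h₂, h₃, h₄, hverts, hσ⟩ := perm_rotates_of_unique_cycle c hc hl huniq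
  simp only [List.nodup_cons, List.mem_cons, List.not_mem_nil, or_false, not_or, not_false_eq_true,
    List.nodup_nil, and_true] at hne
  obtain ⟨⟨hab, had, hae⟩, ⟨hbd, hbe⟩, hde⟩ := hne
  set r : Perm V := swap a b * swap b d * swap d e with hr
  have ra : r a = b := by simp [swap_apply_def, *]
  have rb : r b = d := by simp [swap_apply_def, *, Ne.symm]
  have rd : r d = e := by simp [swap_apply_def, *]; grind
  have re : r e = a := by simp [*]
  have ri : ∀ i, i ≠ a → i ≠ b → i ≠ d → i ≠ e → r i = i := fun i _ _ _ _ => by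
    simp [swap_apply_def, *]
  have hsupp : r.support = {a, b, d, e} := by
    ext i
    simp only [Perm.mem_support, Finset.mem_insert, Finset.mem_singleton]
    clear hr hσ hverts huniq
    clear_value r
    grind
  have hinv : ∀ {x y}, r x = y → r⁻¹ y = x := fun h => by rw [inv_eq_iff_eq, h]
  refine ⟨r, ?_, ?_, ?_, ?_, ?_, ?_⟩
  · simp [hr, hab, hbd, hde]
  · rw [hsupp]
    simp [*]
  · intro i
    rw [hverts, hsupp]
    simp
  · intro i hi
    by_cases hia : i = a
    · subst hia; rwa [ra]
    by_cases hib : i = b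
    · subst hib; rwa [rb]
    by_cases hid : i = d
    · subst hid; rwa [rd]
    by_cases hie : i = e
    · subst hie; rwa [re]
    exact absurd (ri i hia hib hid hie) hi
  · rw [hverts]
    rintro i (rfl | rfl | rfl | rfl) <;> grind
  · intro σ hval hsq
    obtain ⟨w, hw⟩ : ∃ w, σ (σ w) ≠ w := by
      by_contra! h
      exact hsq (Equiv.ext fun x => by rw [sq, mul_apply, h, one_apply])
    rw [hverts]
    rcases hσ σ hval w hw with ⟨h₁, h₂, h₃, h₄⟩ | ⟨h₁, h₂, h₃, h₄⟩
    · left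
      rintro i (rfl | rfl | rfl | rfl)
      · rw [ra, h₁]
      · rw [rb, h₂]
      · rw [rd, h₃]
      · rw [re, h₄]
    · right
      rintro i (rfl | rfl | rfl | rfl)
      · rw [hinv re, h₁]
      · rw [hinv ra, h₄]
      · rw [hinv rb, h₃]
      · rw [hinv rd, h₂]

open Equiv Equiv.Perm in
theorem sign_of_sq_eq_one {V : Type*} [Fintype V] {σ : Perm V} (h : σ ^ 2 = 1) :
    sign σ = (-1) ^ (σ.support.card / 2) := by
  rw [sign_of_pow_two_eq_one h, card_fixedPoints, sum_cycleType,
    Nat.sub_sub_self (Finset.card_le_univ _)]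

theorem charmatrix_adjMat_prod_eq_zero {V : Type*} [Fintype V] {G : SimpleGraph V}
    {σ : Equiv.Perm V} (h : ¬ ∀ i, σ i ≠ i → G.Adj i (σ i)) :
    ∏ i, Matrix.charmatrix (adjMat ℝ G) (σ i) i = 0 := by
  push Not at h
  obtain ⟨i, hi, hadj⟩ := h
  refine Finset.prod_eq_zero (Finset.mem_univ i) ?_
  rw [Matrix.charmatrix_apply_ne _ _ _ hi, adjMat, if_neg fun h => hadj h.symm, map_zero, neg_zero]

theorem charmatrix_adjMat_of_adj {V : Type*} [Fintype V] {G : SimpleGraph V} {i j : V}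
    (h : G.Adj i j) : Matrix.charmatrix (adjMat ℝ G) j i = -1 := by
  rw [Matrix.charmatrix_apply_ne _ _ _ h.ne', adjMat, if_pos h.symm, map_one]

theorem charmatrix_adjMat_prod {V : Type*} [Fintype V] {G : SimpleGraph V}
    {σ : Equiv.Perm V} (h : ∀ i, σ i ≠ i → G.Adj i (σ i)) :
    ∏ i, Matrix.charmatrix (adjMat ℝ G) (σ i) i =
      (-1) ^ σ.support.card * X ^ (Fintype.card V - σ.support.card) := by
  have : ∀ i, Matrix.charmatrix (adjMat ℝ G) (σ i) i = if i ∈ σ.support then -1 else X := by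
    intro i
    split_ifs with hi
    · exact charmatrix_adjMat_of_adj (h i (Equiv.Perm.mem_support.mp hi))
    · rw [Equiv.Perm.notMem_support] at hi
      rw [hi, Matrix.charmatrix_apply_eq, adjMat, if_neg (G.irrefl), map_zero, sub_zero]
  rw [Finset.prod_congr rfl fun i _ => this i, Finset.prod_ite, Finset.prod_const,
    Finset.prod_const, Finset.filter_mem_eq_inter, Finset.univ_inter, ← Finset.compl_filter,
    Finset.card_compl, Finset.filter_mem_eq_inter, Finset.univ_inter]

theorem charmatrix_adjMat_induce {V : Type*} [Fintype V] (G : SimpleGraph V) (s : Set V)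
    [DecidableEq s] :
    Matrix.charmatrix (adjMat ℝ (G.induce s)) =
      (Matrix.charmatrix (adjMat ℝ G)).submatrix (↑) (↑) := by
  ext1 i j
  rw [Matrix.submatrix_apply, Matrix.charmatrix_apply, Matrix.charmatrix_apply]
  simp [Matrix.diagonal_apply, Subtype.ext_iff, adjMat]

/-- The coefficients of the permanental and the determinantal term of a permutation are related
by a sign that depends only on the degree. -/
theorem coeff_charmatrix_adjMat_prod {V : Type*} [Fintype V] {G : SimpleGraph V}
    {σ : Equiv.Perm V} (ε : ℝ)
    (hε : (∀ i, σ i ≠ i → G.Adj i (σ i)) →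
      ((Equiv.Perm.sign σ : ℤ) : ℝ) * ε = (-1) ^ (σ.support.card / 2)) (k : ℕ) :
    (∏ i, Matrix.charmatrix (adjMat ℝ G) (σ i) i).coeff k =
      (-1) ^ ((Fintype.card V - k) / 2) * (ε *
        (((Equiv.Perm.sign σ : ℤ) : ℝ[X]) *
          ∏ i, Matrix.charmatrix (adjMat ℝ G) (σ i) i).coeff k) := by
  by_cases h : ∀ i, σ i ≠ i → G.Adj i (σ i)
  · have hcast : ((Equiv.Perm.sign σ : ℤ) : ℝ[X]) = C ((Equiv.Perm.sign σ : ℤ) : ℝ) := by simp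
    rw [hcast, coeff_C_mul, charmatrix_adjMat_prod h, ← mul_assoc ε, mul_comm ε, hε h]
    have hpow : ((-1) ^ σ.support.card : ℝ[X]) = C ((-1) ^ σ.support.card) := by simp
    rw [hpow, coeff_C_mul, coeff_X_pow]
    have hle : σ.support.card ≤ Fintype.card V := Finset.card_le_univ _
    split_ifs with hk
    · rw [hk, Nat.sub_sub_self hle, ← mul_assoc, ← pow_add, ← two_mul, pow_mul]
      simp
    · simp
  · rw [charmatrix_adjMat_prod_eq_zero h]
    simp

open Equiv Equiv.Perm in
/-- The sign of a permutation moving along edges that rotates the cycle. -/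
theorem sign_of_agree_rotation {V : Type*} [Fintype V] {G : SimpleGraph V} {s : Set V}
    {r σ : Perm V} (hs : ∀ i, i ∈ s ↔ i ∈ r.support) (hsign : sign r = -1)
    (hcard : r.support.card = 4) (hσ : ∀ i, σ i ≠ i → G.Adj i (σ i)) (hσr : ∀ i ∈ s, σ i = r i)
    (hinvol : ∀ τ : Perm V, (∀ i, τ i ≠ i → G.Adj i (τ i)) → (∀ i ∈ s, τ i = i) → τ ^ 2 = 1) :
    ((sign σ : ℤ) : ℝ) * (-1) = (-1) ^ (σ.support.card / 2) := by
  have hτs : ∀ i ∈ s, (r⁻¹ * σ) i = i := fun i hi => by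
    rw [mul_apply, hσr i hi]; exact r.symm_apply_apply i
  have hτn : ∀ i ∉ s, (r⁻¹ * σ) i = σ i := fun i hi => by
    have hσi : σ i ∉ s := fun h => by
      have h' : r⁻¹ (σ i) ∈ s := by
        rw [hs] at h ⊢
        rwa [← support_inv, apply_mem_support, support_inv]
      have : σ (r⁻¹ (σ i)) = σ i := by rw [hσr _ h']; exact r.apply_symm_apply _
      exact hi (by rwa [σ.injective this] at h')
    rw [mul_apply, inv_eq_iff_eq]
    rw [hs, notMem_support] at hσi
    exact hσi.symm
  have hsq : (r⁻¹ * σ) ^ 2 = 1 := by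
    refine hinvol _ (fun i hi => ?_) hτs
    have his : i ∉ s := fun h => hi (hτs i h)
    rw [hτn i his] at hi ⊢
    exact hσ i hi
  have hdisj : Disjoint r (r⁻¹ * σ) := fun i => by
    by_cases h : i ∈ s
    · exact Or.inr (hτs i h)
    · rw [hs, notMem_support] at h
      exact Or.inl h
  have hprod : σ = r * (r⁻¹ * σ) := by rw [mul_inv_cancel_left]
  rw [hprod, hdisj.card_support_mul, hcard, Perm.sign_mul, hsign, sign_of_sq_eq_one hsq,
    show (4 + (r⁻¹ * σ).support.card) / 2 = (r⁻¹ * σ).support.card / 2 + 2 by omega]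
  push_cast
  ring

open Equiv Equiv.Perm in
theorem permPolyG_coeff_of_unique_four_cycle {V : Type*} [Fintype V] {G : SimpleGraph V} {v : V}
    (c : G.Walk v v) (hc : c.IsCycle) (hl : c.length = 4)
    (huniq : ∀ R : G.Subgraph, IsCycleSubgraph G R → R = c.toSubgraph) (k : ℕ) :
    (permPolyG ℝ G).coeff k = (-1) ^ ((Fintype.card V - k) / 2) *
      (charPolyG ℝ G + 4 * charPolyG ℝ (G.induce (c.toSubgraph.vertsᶜ))).coeff k := by
  obtain ⟨r, hsign, hcard, hs, hr, hrr, hrot⟩ := exists_rotation c hc hl huniq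
  set s := c.toSubgraph.verts with hsdef
  have hv : v ∈ s := by simp [hsdef]
  have hs' : ∀ i, i ∈ s ↔ i ∈ (r⁻¹).support := fun i => by rw [support_inv, hs]
  have hmem : ∀ i ∈ s, r i ∈ s := fun i hi => by
    rw [hs] at hi ⊢; rwa [apply_mem_support]
  have hmem' : ∀ i ∈ s, r⁻¹ i ∈ s := fun i hi => by
    rw [hs'] at hi ⊢; rwa [apply_mem_support]
  have hr' : ∀ i, r⁻¹ i ≠ i → G.Adj i (r⁻¹ i) := fun i hi => by
    have := hr (r⁻¹ i) (fun h => hi (by rw [← h]; simp))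
    simpa using this.symm
  have hne : ∀ i ∈ s, r i ≠ r⁻¹ i := fun i hi h => hrr i hi (by rw [h]; simp)
  set M := Matrix.charmatrix (adjMat ℝ G) with hM
  set w : Perm V → ℝ[X] := fun σ => ∏ i, M (σ i) i with hw
  set F := charPolyG ℝ (G.induce sᶜ) with hF
  have hinvol : ∀ τ : Perm V, (∀ i, τ i ≠ i → G.Adj i (τ i)) → (∀ i ∈ s, τ i = i) →
      τ ^ 2 = 1 := by
    intro τ hτ hfix
    by_contra hsq
    rcases hrot τ hτ hsq with h | h
    · exact (mem_support.mp ((hs v).mp hv)) (by rw [← h v hv, hfix v hv])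
    · exact (mem_support.mp ((hs' v).mp hv)) (by rw [← h v hv, hfix v hv])
  have hsub : (M.submatrix ((↑) : ↑sᶜ → V) (↑)).det = F := by
    rw [hM, ← charmatrix_adjMat_induce, hF]
    unfold charPolyG Matrix.charpoly
    congr!
  have hscard : Fintype.card s = 4 := by
    rw [← hcard, ← Fintype.card_coe]
    exact Fintype.card_congr (Equiv.subtypeEquivRight hs)
  have hagree : ∀ q : Perm V, sign q = -1 → (∀ i, i ∈ s ↔ i ∈ q.support) →
      (∀ i, q i ≠ i → G.Adj i (q i)) →
      ∑ σ : Perm V with ∀ i ∈ s, σ i = q i, ((sign σ : ℤ) : ℝ[X]) * w σ = -F := by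
    intro q hq hqs hqadj
    rw [sum_perm_agree M s q fun i hi => notMem_support.mp fun h => hi ((hqs i).mpr h), hsub, hq,
      Finset.prod_congr rfl fun (i : s) _ =>
        charmatrix_adjMat_of_adj (hqadj i (mem_support.mp ((hqs i).mp i.2))),
      Finset.prod_const, Finset.card_univ, hscard]
    norm_num
  have hnoninv : ∑ σ : Perm V with ¬ σ ^ 2 = 1, ((sign σ : ℤ) : ℝ[X]) * w σ = -2 * F := by
    have hunion : ∑ σ : Perm V with ¬ σ ^ 2 = 1, ((sign σ : ℤ) : ℝ[X]) * w σ =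
        ∑ σ ∈ ({σ : Perm V | ∀ i ∈ s, σ i = r i} : Finset (Perm V)) ∪
          ({σ : Perm V | ∀ i ∈ s, σ i = r⁻¹ i} : Finset (Perm V)),
          ((sign σ : ℤ) : ℝ[X]) * w σ := by
      symm
      refine Finset.sum_subset_zero_on_sdiff ?_ ?_ fun _ _ => rfl
      · intro σ hσ
        simp only [Finset.mem_union, Finset.mem_filter, Finset.mem_univ, true_and] at hσ ⊢
        intro hsq
        have hσσ : σ (σ v) = v := by rw [← mul_apply, ← sq, hsq, one_apply]
        rcases hσ with h | h
        · exact hrr v hv (by rwa [h v hv, h _ (hmem v hv)] at hσσ)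
        · rw [h v hv, h _ (hmem' v hv)] at hσσ
          refine hrr v hv ?_
          conv_lhs => rw [← hσσ]
          simp
      · intro σ hσ
        simp only [Finset.mem_union, Finset.mem_filter, Finset.mem_univ, true_and,
          Finset.mem_sdiff] at hσ
        rw [hw]
        simp only
        rw [hM, charmatrix_adjMat_prod_eq_zero fun h => hσ.2 (hrot σ h hσ.1), mul_zero]
    rw [hunion, Finset.sum_union, hagree r hsign hs hr,
      hagree r⁻¹ (by rw [sign_inv, hsign]) hs' hr']
    · ring
    · rw [Finset.disjoint_filter]
      intro σ _ h h'
      exact hne v hv (by rw [← h v hv, h' v hv])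
  have hdet : charPolyG ℝ G = ∑ σ : Perm V with σ ^ 2 = 1, ((sign σ : ℤ) : ℝ[X]) * w σ +
      ∑ σ : Perm V with ¬ σ ^ 2 = 1, ((sign σ : ℤ) : ℝ[X]) * w σ := by
    rw [Finset.sum_filter_add_sum_filter_not, charPolyG, Matrix.charpoly, Matrix.det_apply']
  have hper : permPolyG ℝ G = ∑ σ : Perm V with σ ^ 2 = 1, w σ +
      ∑ σ : Perm V with ¬ σ ^ 2 = 1, w σ := by
    rw [Finset.sum_filter_add_sum_filter_not, permPolyG, Matrix.permanent]
  have hinv : (∑ σ : Perm V with σ ^ 2 = 1, w σ).coeff k = (-1) ^ ((Fintype.card V - k) / 2) *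
      (∑ σ : Perm V with σ ^ 2 = 1, ((sign σ : ℤ) : ℝ[X]) * w σ).coeff k := by
    rw [finsetSum_coeff, finsetSum_coeff, Finset.mul_sum]
    refine Finset.sum_congr rfl fun σ hσ => ?_
    refine (coeff_charmatrix_adjMat_prod 1 (fun _ => ?_) k).trans (by rw [one_mul])
    rw [sign_of_sq_eq_one (Finset.mem_filter.mp hσ).2]
    simp
  have hninv : (∑ σ : Perm V with ¬ σ ^ 2 = 1, w σ).coeff k =
      (-1) ^ ((Fintype.card V - k) / 2) *
      (-(∑ σ : Perm V with ¬ σ ^ 2 = 1, ((sign σ : ℤ) : ℝ[X]) * w σ).coeff k) := by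
    rw [finsetSum_coeff, finsetSum_coeff, ← Finset.sum_neg_distrib, Finset.mul_sum]
    refine Finset.sum_congr rfl fun σ hσ => ?_
    refine (coeff_charmatrix_adjMat_prod (-1) (fun h => ?_) k).trans (by rw [neg_one_mul])
    rcases hrot σ h (Finset.mem_filter.mp hσ).2 with h' | h'
    · exact sign_of_agree_rotation hs hsign hcard h h' hinvol
    · exact sign_of_agree_rotation hs' (by rw [sign_inv, hsign]) (by rw [support_inv, hcard])
        h h' hinvol
  rw [hper, coeff_add, hinv, hninv, hdet, hnoninv, ← mul_add, ← coeff_neg, ← coeff_add]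
  congr 2
  ring

/-- Let `G₁`, `G₂` be unicyclic bipartite graphs on the same number of
vertices whose unique cycles `C₁`, `C₂` are 4-cycles, and suppose `G₁∖C₁` and `G₂∖C₂` are
cospectral. Then `G₁` and `G₂` are cospectral iff they are per-cospectral. -/
theorem stmt_13 {V₁ V₂ : Type*} [Fintype V₁] [Fintype V₂]
    (G₁ : SimpleGraph V₁) (G₂ : SimpleGraph V₂)
    (hbip₁ : G₁.Colorable 2) (hbip₂ : G₂.Colorable 2)
    (hconn₁ : G₁.Connected) (hconn₂ : G₂.Connected)
    (hn : Fintype.card V₁ = Fintype.card V₂)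
    (v₁ : V₁) (c₁ : G₁.Walk v₁ v₁) (hc₁ : c₁.IsCycle) (hl₁ : c₁.length = 4)
    (huniq₁ : ∀ R : G₁.Subgraph, IsCycleSubgraph G₁ R → R = c₁.toSubgraph)
    (v₂ : V₂) (c₂ : G₂.Walk v₂ v₂) (hc₂ : c₂.IsCycle) (hl₂ : c₂.length = 4)
    (huniq₂ : ∀ R : G₂.Subgraph, IsCycleSubgraph G₂ R → R = c₂.toSubgraph)
    (hdel : charPolyG ℝ (G₁.induce (c₁.toSubgraph.vertsᶜ))
      = charPolyG ℝ (G₂.induce (c₂.toSubgraph.vertsᶜ))) :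
    charPolyG ℝ G₁ = charPolyG ℝ G₂ ↔ permPolyG ℝ G₁ = permPolyG ℝ G₂ := by
  have h₁ := permPolyG_coeff_of_unique_four_cycle c₁ hc₁ hl₁ huniq₁
  have h₂ := permPolyG_coeff_of_unique_four_cycle c₂ hc₂ hl₂ huniq₂
  constructor
  · intro h
    ext k
    rw [h₁, h₂, hn, h, hdel]
  · intro h
    ext k
    have hk := h₁ k
    rw [h, h₂, hn, hdel, mul_right_inj' (pow_ne_zero _ (by norm_num)), coeff_add, coeff_add] at hk
    exact (add_right_cancel hk).symm

end
end

section
/- Let G be a finite simple unicyclic bipartite graph on n vertices whose unique cycle R has length divisible by 4. Then π(G,x) = φ_p(G,x) + 4·φ_p(G∖R, x), where π(G,x) = per(xI − A(G)) is the permanental polynomial, φ_p denotes the modified characteristic polynomial (for a bipartite graph H on m vertices, φ_p(H,x) = Σ_{i even} (−1)^{i/2} a_i(H) x^{m−i} where a_i(H) are the coefficients of det(xI − A(H))), and G∖R is the induced subgraph obtained by deleting the vertices of R. -/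
open Polynomial SimpleGraph
open scoped Classical

noncomputable section

/-- The permutations moving every vertex, if at all, to an adjacent vertex. -/
def adjPerms {V : Type*} [Fintype V] (G : SimpleGraph V) : Finset (Equiv.Perm V) :=
  Finset.univ.filter fun σ => ∀ x, σ x = x ∨ G.Adj (σ x) x

lemma mem_adjPerms {V : Type*} [Fintype V] {G : SimpleGraph V} {σ : Equiv.Perm V} :
    σ ∈ adjPerms G ↔ ∀ x, σ x = x ∨ G.Adj (σ x) x := by
  simp [adjPerms]

lemma card_support_le_card {V : Type*} [Fintype V] (σ : Equiv.Perm V) :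
    σ.support.card ≤ Fintype.card V := Finset.card_le_univ _

lemma prod_charmatrix_adjMat {V : Type*} [Fintype V] (G : SimpleGraph V) (σ : Equiv.Perm V) :
    ∏ i, (adjMat ℝ G).charmatrix (σ i) i =
      if σ ∈ adjPerms G then
        (-1) ^ σ.support.card * X ^ (Fintype.card V - σ.support.card) else 0 := by
  split_ifs with h
  · rw [mem_adjPerms] at h
    have key : ∀ i, (adjMat ℝ G).charmatrix (σ i) i = if i ∈ σ.support then -1 else X := by
      intro i
      split_ifs with hi
      · rw [Equiv.Perm.mem_support] at hi
        rw [Matrix.charmatrix_apply_ne _ _ _ hi]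
        simp [adjMat, (h i).resolve_left hi]
      · rw [Equiv.Perm.notMem_support] at hi
        rw [hi, Matrix.charmatrix_apply_eq]
        simp [adjMat]
    rw [Finset.prod_congr rfl fun i _ => key i, Finset.prod_ite, Finset.prod_const,
      Finset.prod_const, Finset.filter_mem_eq_inter, Finset.univ_inter, Finset.filter_not,
      Finset.filter_mem_eq_inter, Finset.univ_inter, ← Finset.compl_eq_univ_sdiff,
      Finset.card_compl]
  · simp only [mem_adjPerms, not_forall, not_or] at h
    obtain ⟨i, hi, hadj⟩ := h
    refine Finset.prod_eq_zero (Finset.mem_univ i) ?_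
    rw [Matrix.charmatrix_apply_ne _ _ _ hi]
    simp [adjMat, hadj]

lemma permPolyG_eq_sum {V : Type*} [Fintype V] (G : SimpleGraph V) :
    permPolyG ℝ G = ∑ σ ∈ adjPerms G,
      (-1) ^ σ.support.card * X ^ (Fintype.card V - σ.support.card) := by
  rw [permPolyG, Matrix.permanent, Finset.sum_congr rfl fun σ _ => prod_charmatrix_adjMat G σ,
    Finset.sum_ite_mem, Finset.univ_inter]

lemma charPolyG_eq_sum {V : Type*} [Fintype V] (G : SimpleGraph V) :
    charPolyG ℝ G = ∑ σ ∈ adjPerms G,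
      C (((Equiv.Perm.sign σ : ℤ) : ℝ) * (-1) ^ σ.support.card) *
        X ^ (Fintype.card V - σ.support.card) := by
  rw [charPolyG, Matrix.charpoly, Matrix.det_apply',
    Finset.sum_congr rfl fun σ _ => congrArg _ (prod_charmatrix_adjMat G σ)]
  simp only [mul_ite, mul_zero]
  rw [Finset.sum_ite_mem, Finset.univ_inter]
  refine Finset.sum_congr rfl fun σ _ => ?_
  simp [mul_assoc]

lemma phiP_eq_sum {V : Type*} [Fintype V] (G : SimpleGraph V) :
    phiP G = ∑ σ ∈ adjPerms G,
      if Even σ.support.card then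
        C ((-1) ^ (σ.support.card / 2) * ((Equiv.Perm.sign σ : ℤ) : ℝ)) *
          X ^ (Fintype.card V - σ.support.card)
      else 0 := by
  have hcoeff : ∀ i ∈ Finset.range (Fintype.card V + 1),
      (charPolyG ℝ G).coeff (Fintype.card V - i) = ∑ σ ∈ adjPerms G,
        if i = σ.support.card then ((Equiv.Perm.sign σ : ℤ) : ℝ) * (-1) ^ i else 0 := by
    intro i hi
    rw [Finset.mem_range] at hi
    rw [charPolyG_eq_sum, finsetSum_coeff]
    refine Finset.sum_congr rfl fun σ _ => ?_
    have := card_support_le_card σ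
    rw [coeff_C_mul_X_pow]
    by_cases h : i = σ.support.card
    · subst h; simp
    · rw [if_neg h, if_neg (by omega)]
  calc phiP G = ∑ i ∈ Finset.range (Fintype.card V + 1), ∑ σ ∈ adjPerms G,
        if i = σ.support.card then
          if Even i then C ((-1) ^ (i / 2) * ((Equiv.Perm.sign σ : ℤ) : ℝ)) *
            X ^ (Fintype.card V - i) else 0 else 0 := by
        refine Finset.sum_congr rfl fun i hi => ?_
        split_ifs with he
        · rw [hcoeff i hi, Finset.mul_sum, map_sum, Finset.sum_mul]
          refine Finset.sum_congr rfl fun σ _ => ?_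
          split_ifs <;> simp [he.neg_one_pow]
        · simp
    _ = _ := by
        rw [Finset.sum_comm]
        refine Finset.sum_congr rfl fun σ _ => ?_
        rw [Finset.sum_ite_eq', if_pos]
        have := card_support_le_card σ
        simp only [Finset.mem_range]
        omega

/-- `τ` is a cyclic permutation of order at least three moving vertices along edges of `G`. -/
structure IsAdjCycle {V : Type*} [Fintype V] (G : SimpleGraph V) (τ : Equiv.Perm V) : Prop where
  mem : τ ∈ adjPerms G
  isCycle : τ.IsCycle
  sq_ne_one : τ ^ 2 ≠ 1

lemma inv_mem_adjPerms {V : Type*} [Fintype V] {G : SimpleGraph V} {τ : Equiv.Perm V}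
    (h : τ ∈ adjPerms G) : τ⁻¹ ∈ adjPerms G := by
  rw [mem_adjPerms] at h ⊢
  intro x
  have := h (τ⁻¹ x)
  rw [show τ (τ⁻¹ x) = x from τ.apply_symm_apply x] at this
  exact this.imp Eq.symm fun h => h.symm

namespace IsAdjCycle

variable {V : Type*} [Fintype V] {G : SimpleGraph V} {τ ρ : Equiv.Perm V}

protected lemma inv (h : IsAdjCycle G τ) : IsAdjCycle G τ⁻¹ :=
  ⟨inv_mem_adjPerms h.mem, h.isCycle.inv, by simpa using h.sq_ne_one⟩

lemma adj (h : IsAdjCycle G τ) {x : V} (hx : τ x ≠ x) : G.Adj (τ x) x :=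
  (mem_adjPerms.1 h.mem x).resolve_left hx

lemma apply_apply_ne (h : IsAdjCycle G τ) {x : V} (hx : τ x ≠ x) : τ (τ x) ≠ x := fun h' =>
  h.sq_ne_one ((h.isCycle.pow_eq_one_iff' hx).2 (by simpa [pow_two] using h'))

lemma ne_inv (h : IsAdjCycle G τ) : τ ≠ τ⁻¹ := fun h' =>
  h.sq_ne_one (by rw [pow_two]; nth_rewrite 2 [h']; exact mul_inv_cancel τ)

/-- The orbit of a cyclic permutation along edges is traced by a cycle of the graph. -/
lemma exists_walk (h : IsAdjCycle G τ) : ∃ (v : V) (w : G.Walk v v), w.IsCycle ∧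
    ∀ x y, w.toSubgraph.Adj x y ↔ τ x ≠ x ∧ (τ x = y ∨ τ y = x) := by
  obtain ⟨x, hx, hsame⟩ := h.isCycle
  have hmoved (i : ℕ) : τ ((τ ^ i) x) ≠ (τ ^ i) x := by
    rw [← Equiv.Perm.mul_apply, ← pow_succ', pow_succ, Equiv.Perm.mul_apply]
    exact fun h' => hx ((τ ^ i).injective h')
  set n := orderOf τ
  have hn3 : 3 ≤ n := by
    have h1 : 0 < n := orderOf_pos τ
    have h2 : n ≠ 1 := fun h' => h.isCycle.ne_one (orderOf_eq_one_iff.1 h')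
    have h3 : n ≠ 2 := fun h' => h.sq_ne_one (by rw [← h']; exact pow_orderOf_eq_one τ)
    omega
  have hinj (i j : ℕ) (hi : i < n) (hj : j < n) (hij : (τ ^ i) x = (τ ^ j) x) : i = j := by
    refine pow_injOn_Iio_orderOf hi hj (h.isCycle.pow_eq_pow_iff.2 ⟨x, hx, hij⟩)
  have hwalk (m : ℕ) : ∃ p : G.Walk x ((τ ^ m) x), p.length = m ∧ (m < n → p.IsPath) ∧
      (∀ y ∈ p.support, ∃ i ≤ m, (τ ^ i) x = y) ∧
      ∀ e, e ∈ p.edges ↔ ∃ i < m, e = s((τ ^ i) x, (τ ^ (i + 1)) x) := by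
    induction m with
    | zero =>
      exact ⟨(SimpleGraph.Walk.nil : G.Walk x x), rfl, fun _ => SimpleGraph.Walk.IsPath.nil,
        fun y hy => ⟨0, le_rfl, (List.mem_singleton.1 hy).symm⟩,
        fun e => ⟨fun h => absurd h List.not_mem_nil, fun ⟨i, hi, _⟩ => absurd hi i.not_lt_zero⟩⟩
    | succ m ih =>
      obtain ⟨p, hl, hp, hs, he⟩ := ih
      have hadj : G.Adj ((τ ^ m) x) ((τ ^ (m + 1)) x) := by
        rw [pow_succ', Equiv.Perm.mul_apply]
        exact (h.adj (hmoved m)).symm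
      refine ⟨p.concat hadj, by simp [hl], fun hm => (hp (by omega)).concat ?_ hadj, ?_, ?_⟩
      · intro hmem
        obtain ⟨i, hi, hix⟩ := hs _ hmem
        have := hinj i (m + 1) (by omega) hm hix
        omega
      · intro y hy
        rw [SimpleGraph.Walk.support_concat, List.mem_append, List.mem_singleton] at hy
        rcases hy with hy | rfl
        · obtain ⟨i, hi, hix⟩ := hs _ hy
          exact ⟨i, by omega, hix⟩
        · exact ⟨m + 1, le_rfl, rfl⟩
      · intro e
        rw [SimpleGraph.Walk.edges_concat, List.concat_eq_append, List.mem_append, List.mem_singleton, he]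
        constructor
        · rintro (⟨i, hi, rfl⟩ | rfl)
          · exact ⟨i, by omega, rfl⟩
          · exact ⟨m, by omega, rfl⟩
        · rintro ⟨i, hi, rfl⟩
          rcases Nat.lt_succ_iff_lt_or_eq.1 hi with hi | rfl
          · exact Or.inl ⟨i, hi, rfl⟩
          · exact Or.inr rfl
  obtain ⟨p, hl, hp, hs, he⟩ := hwalk (n - 1)
  have hclose : τ ((τ ^ (n - 1)) x) = x := by
    rw [← Equiv.Perm.mul_apply, ← pow_succ', show n - 1 + 1 = n by omega, pow_orderOf_eq_one,
      Equiv.Perm.one_apply]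
  have hadj : G.Adj ((τ ^ (n - 1)) x) x := by
    have := h.adj (hmoved (n - 1))
    rw [hclose] at this
    exact this.symm
  refine ⟨_, SimpleGraph.Walk.cons hadj p, ?_, ?_⟩
  · rw [SimpleGraph.Walk.cons_isCycle_iff]
    refine ⟨hp (by omega), fun hmem => ?_⟩
    obtain ⟨i, hi, hie⟩ := (he _).1 hmem
    rcases Sym2.eq_iff.1 hie with ⟨h1, h2⟩ | ⟨h1, h2⟩
    · have := hinj _ _ (by omega) (by omega) h1
      omega
    · have h3 := hinj _ _ (by omega) (by omega) h1
      have h4 := hinj 0 i (by omega) (by omega) h2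
      omega
  · intro a b
    rw [SimpleGraph.Walk.adj_toSubgraph_iff_mem_edges, SimpleGraph.Walk.edges_cons, List.mem_cons,
      he]
    have hpow (y : V) (hy : τ y ≠ y) : ∃ i < n, (τ ^ i) x = y :=
      (hsame hy).exists_pow_eq'
    have hstep (i : ℕ) : (τ ^ (i + 1)) x = τ ((τ ^ i) x) := by
      rw [pow_succ', Equiv.Perm.mul_apply]
    have hmove (y : V) (hy : τ y ≠ y) : s(y, τ y) = s((τ ^ (n - 1)) x, x) ∨
        ∃ i < n - 1, s(y, τ y) = s((τ ^ i) x, (τ ^ (i + 1)) x) := by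
      obtain ⟨i, hi, rfl⟩ := hpow y hy
      rcases Nat.lt_or_ge i (n - 1) with hi' | hi'
      · exact Or.inr ⟨i, hi', by rw [hstep]⟩
      · obtain rfl : i = n - 1 := by omega
        exact Or.inl (by rw [hclose])
    constructor
    · rintro (h1 | ⟨i, hi, h1⟩)
      · rcases Sym2.eq_iff.1 h1 with ⟨rfl, rfl⟩ | ⟨rfl, rfl⟩
        · exact ⟨hmoved _, Or.inl hclose⟩
        · exact ⟨hx, Or.inr hclose⟩
      · rcases Sym2.eq_iff.1 h1 with ⟨rfl, rfl⟩ | ⟨rfl, rfl⟩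
        · exact ⟨hmoved _, Or.inl (hstep i).symm⟩
        · exact ⟨hmoved _, Or.inr (hstep i).symm⟩
    · rintro ⟨ha, rfl | rfl⟩
      · exact hmove a ha
      · rw [Sym2.eq_swap]
        exact hmove b fun h' => ha (congrArg τ h')

/-- Cyclic permutations tracing the same cycle subgraph agree up to direction. -/
lemma eq_or_eq_inv (hτ : IsAdjCycle G τ) (hρ : IsAdjCycle G ρ)
    (h : ∀ x y, (τ x ≠ x ∧ (τ x = y ∨ τ y = x)) ↔ (ρ x ≠ x ∧ (ρ x = y ∨ ρ y = x))) :
    τ = ρ ∨ τ = ρ⁻¹ := by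
  have key {ρ : Equiv.Perm V} (hρ : IsAdjCycle G ρ)
      (h : ∀ x y, (τ x ≠ x ∧ (τ x = y ∨ τ y = x)) ↔ (ρ x ≠ x ∧ (ρ x = y ∨ ρ y = x)))
      {x₀ : V} (hx₀ : τ x₀ ≠ x₀) (h₀ : τ x₀ = ρ x₀) : τ = ρ := by
    have hmoved (x : V) (hx : τ x ≠ x) : ρ x ≠ x := ((h x (τ x)).1 ⟨hx, Or.inl rfl⟩).1
    have hmoved' (x : V) (hx : ρ x ≠ x) : τ x ≠ x := ((h x (ρ x)).2 ⟨hx, Or.inl rfl⟩).1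
    have hpow (i : ℕ) : τ ((τ ^ i) x₀) ≠ (τ ^ i) x₀ ∧ τ ((τ ^ i) x₀) = ρ ((τ ^ i) x₀) := by
      induction i with
      | zero => exact ⟨hx₀, h₀⟩
      | succ i ih =>
        rw [pow_succ', Equiv.Perm.mul_apply]
        set y := (τ ^ i) x₀
        have hy : τ (τ y) ≠ τ y := fun h' => ih.1 (τ.injective h')
        refine ⟨hy, ?_⟩
        rcases ((h (τ y) (τ (τ y))).1 ⟨hy, Or.inl rfl⟩).2 with h1 | h1
        · exact h1.symm
        · exact absurd (ρ.injective (h1.trans ih.2)) (hτ.apply_apply_ne ih.1)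
    ext y
    by_cases hy : τ y = y
    · rw [hy]
      by_contra h'
      exact hmoved' y (Ne.symm h') hy
    · obtain ⟨i, rfl⟩ := hτ.isCycle.exists_pow_eq hx₀ hy
      exact (hpow i).2
  obtain ⟨x₀, hx₀, -⟩ := id hτ.isCycle
  rcases ((h x₀ (τ x₀)).1 ⟨hx₀, Or.inl rfl⟩).2 with h1 | h1
  · exact Or.inl (key hρ h hx₀ h1.symm)
  · refine Or.inr (key hρ.inv (fun x y => (h x y).trans ?_) hx₀ (Equiv.Perm.eq_inv_iff_eq.2 h1))
    rw [Equiv.Perm.inv_eq_iff_eq, Equiv.Perm.inv_eq_iff_eq, Ne, Ne, Equiv.Perm.inv_eq_iff_eq]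
    grind

end IsAdjCycle

lemma isAdjCycle_cycleOf {V : Type*} [Fintype V] {G : SimpleGraph V} {σ : Equiv.Perm V}
    (hσ : σ ∈ adjPerms G) {x : V} (hx : σ (σ x) ≠ x) : IsAdjCycle G (σ.cycleOf x) := by
  have hx' : σ x ≠ x := fun h => hx (by rw [h, h])
  refine ⟨mem_adjPerms.2 fun y => ?_, Equiv.Perm.isCycle_cycleOf σ hx', fun h => hx ?_⟩
  · rw [Equiv.Perm.cycleOf_apply]
    split_ifs
    · exact mem_adjPerms.1 hσ y
    · exact Or.inl rfl
  · have := Equiv.Perm.cycleOf_pow_apply_self σ x 2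
    rw [h, pow_two] at this
    exact this.symm

/-- A cycle of the graph is traced by a cyclic permutation. -/
lemma exists_isAdjCycle_of_isCycle {V : Type*} [Fintype V] {G : SimpleGraph V} {v : V}
    {c : G.Walk v v} (hc : c.IsCycle) :
    ∃ ρ, IsAdjCycle G ρ ∧ ρ.support = c.support.toFinset ∧ ρ.support.card = c.length := by
  set l := c.support.dropLast with hl
  have hnd : l.Nodup := hc.nodup_dropLast_support
  have hlen : l.length = c.length := by simp [hl]
  have h3 := hc.three_le_length
  have hsupp : l.formPerm.support = l.toFinset := by
    refine List.support_formPerm_of_nodup l hnd fun x hx => ?_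
    rw [hx] at hlen
    simp at hlen
    omega
  have hcard : l.formPerm.support.card = c.length := by
    rw [hsupp, List.toFinset_card_of_nodup hnd, hlen]
  have hcyc : l.formPerm.IsCycle := List.isCycle_formPerm hnd (by omega)
  have hget (i : ℕ) (hi : i < l.length) : l[i] = c.getVert i := by
    rw [List.getElem_dropLast, SimpleGraph.Walk.support_getElem_eq_getVert]
  have hmem (x : V) : x ∈ l ↔ x ∈ c.support := by
    rw [← c.tail_support_perm_dropLast_support.mem_iff, ← c.cons_tail_support, List.mem_cons,
      List.tail_cons]
    exact ⟨Or.inr, fun h => h.elim (fun h => h ▸ c.end_mem_tail_support hc.not_nil) id⟩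
  refine ⟨l.formPerm, ⟨mem_adjPerms.2 fun x => ?_, hcyc, fun h => ?_⟩, ?_, hcard⟩
  · by_cases hx : x ∈ l
    · right
      obtain ⟨i, hi, rfl⟩ := List.mem_iff_getElem.1 hx
      rw [List.formPerm_apply_getElem l hnd i hi, hget, hget]
      have := c.adj_getVert_succ (i := i) (by omega)
      rcases Nat.lt_or_ge (i + 1) l.length with h' | h'
      · rw [Nat.mod_eq_of_lt h']
        exact this.symm
      · obtain h' : i + 1 = l.length := by omega
        rw [h', hlen, c.getVert_length] at this
        rw [h', Nat.mod_self, c.getVert_zero]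
        exact this.symm
    · exact Or.inl (List.formPerm_apply_of_notMem hx)
  · have := orderOf_dvd_of_pow_eq_one h
    rw [hcyc.orderOf, hcard] at this
    have := Nat.le_of_dvd (by omega) this
    omega
  · rw [hsupp]
    ext x
    simpa using hmem x

lemma even_card_support_and_sign_of_sq_eq_one {V : Type*} [Fintype V] {σ : Equiv.Perm V}
    (h : σ ^ 2 = 1) : Even σ.support.card ∧
      Equiv.Perm.sign σ = (-1) ^ (σ.support.card / 2) := by
  have hrep := Multiset.eq_replicate_card.2 (Equiv.Perm.pow_prime_eq_one_iff.1 h)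
  have hcard : σ.support.card = Multiset.card σ.cycleType * 2 := by
    rw [← Equiv.Perm.sum_cycleType, hrep]
    simp
  refine ⟨⟨_, by rw [hcard, mul_two]⟩, ?_⟩
  rw [Equiv.Perm.sign_of_cycleType, Equiv.Perm.sum_cycleType, hcard, Nat.mul_div_cancel _ two_pos,
    pow_add, Even.neg_one_pow ⟨_, mul_two _⟩, one_mul]

/-- If no cycle contributes, the modified characteristic polynomial counts matchings. -/
lemma phiP_eq_sum_of_sq_eq_one {V : Type*} [Fintype V] {G : SimpleGraph V}
    (h : ∀ σ ∈ adjPerms G, σ ^ 2 = 1) :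
    phiP G = ∑ σ ∈ adjPerms G, X ^ (Fintype.card V - σ.support.card) := by
  rw [phiP_eq_sum]
  refine Finset.sum_congr rfl fun σ hσ => ?_
  obtain ⟨he, hs⟩ := even_card_support_and_sign_of_sq_eq_one (h σ hσ)
  rw [if_pos he, hs]
  push_cast
  rw [← mul_pow]
  simp

lemma disjoint_ofSubtype {V : Type*} {ρ : Equiv.Perm V} {S : Set V}
    (hS : ∀ x, x ∈ S ↔ ρ x = x) (τ : Equiv.Perm S) :
    (Equiv.Perm.ofSubtype τ).Disjoint ρ := by
  intro x
  by_cases hx : x ∈ S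
  · exact Or.inr ((hS x).1 hx)
  · exact Or.inl (Equiv.Perm.ofSubtype_apply_of_not_mem τ hx)

lemma eq_and_eq_of_ofSubtype_mul_eq {V : Type*} {ρ : Equiv.Perm V} {S : Set V}
    (hS : ∀ x, x ∈ S ↔ ρ x = x) {τ τ' : Equiv.Perm S}
    {r r' : Equiv.Perm V} (hr : r = ρ ∨ r = ρ⁻¹)
    (hr' : r' = ρ ∨ r' = ρ⁻¹)
    (h : Equiv.Perm.ofSubtype τ * r = Equiv.Perm.ofSubtype τ' * r') : τ = τ' ∧ r = r' := by
  have hfix {r : Equiv.Perm V} (hr : r = ρ ∨ r = ρ⁻¹) (x : V) :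
      x ∈ S ↔ r x = x := by
    rcases hr with rfl | rfl <;> rw [hS]
    rw [Equiv.Perm.inv_eq_iff_eq, eq_comm]
  have hout {τ : Equiv.Perm S} {r : Equiv.Perm V} (hr : r = ρ ∨ r = ρ⁻¹)
      {x : V} (hx : x ∉ S) : (Equiv.Perm.ofSubtype τ * r) x = r x :=
    Equiv.Perm.ofSubtype_apply_of_not_mem _ fun h =>
      hx ((hfix hr x).2 (r.injective ((hfix hr _).1 h)))
  have hrr : r = r' := by
    ext x
    by_cases hx : x ∈ S
    · rw [(hfix hr x).1 hx, (hfix hr' x).1 hx]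
    · rw [← hout hr hx, h, hout hr' hx]
  subst hrr
  exact ⟨Equiv.Perm.ofSubtype_injective (mul_right_cancel h), rfl⟩

section Unicyclic

variable {V : Type*} [Fintype V] {G : SimpleGraph V} {ρ : Equiv.Perm V} {S : Set V}
  [Fintype S]

lemma ofSubtype_mem_adjPerms {τ : Equiv.Perm S} (hτ : τ ∈ adjPerms (G.induce S)) :
    Equiv.Perm.ofSubtype τ ∈ adjPerms G := by
  rw [mem_adjPerms] at hτ ⊢
  intro x
  by_cases hx : x ∈ S
  · rw [Equiv.Perm.ofSubtype_apply_of_mem τ hx]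
    exact (hτ ⟨x, hx⟩).imp (congrArg Subtype.val) id
  · exact Or.inl (Equiv.Perm.ofSubtype_apply_of_not_mem τ hx)

lemma mul_mem_adjPerms_of_disjoint {σ τ : Equiv.Perm V} (hσ : σ ∈ adjPerms G)
    (hτ : τ ∈ adjPerms G) (h : σ.Disjoint τ) : σ * τ ∈ adjPerms G := by
  rw [mem_adjPerms] at hσ hτ ⊢
  intro x
  rcases h x with hx | hx
  · rw [h.commute.eq, Equiv.Perm.mul_apply, hx]
    exact hτ x
  · rw [Equiv.Perm.mul_apply, hx]
    exact hσ x

lemma sq_eq_one_of_mem_adjPerms_induce (huniq : ∀ τ, IsAdjCycle G τ → τ = ρ ∨ τ = ρ⁻¹)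
    (hS : ∀ x, x ∈ S ↔ ρ x = x) {τ : Equiv.Perm S} (hτ : τ ∈ adjPerms (G.induce S)) :
    τ ^ 2 = 1 := by
  ext x
  by_contra hx
  set σ := Equiv.Perm.ofSubtype τ with hσ
  have happ (y : S) : σ y = τ y := Equiv.Perm.ofSubtype_apply_coe τ y
  have hx2 : σ (σ x) ≠ x := by
    rw [happ, happ]
    exact hx
  have hfix : ρ x = x := (hS x).1 x.2
  have hmove : σ x ≠ x := fun h => hx2 (by rw [h, h])
  have hc := Equiv.Perm.cycleOf_apply_self σ (x : V)
  rcases huniq _ (isAdjCycle_cycleOf (ofSubtype_mem_adjPerms hτ) hx2) with h | h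
  · rw [h, hfix] at hc
    exact hmove hc.symm
  · rw [h, Equiv.Perm.inv_eq_iff_eq.2 hfix.symm] at hc
    exact hmove hc.symm

lemma exists_eq_ofSubtype_mul (huniq : ∀ τ, IsAdjCycle G τ → τ = ρ ∨ τ = ρ⁻¹)
    (hS : ∀ x, x ∈ S ↔ ρ x = x) {σ : Equiv.Perm V} (hσ : σ ∈ adjPerms G) (h2 : σ ^ 2 ≠ 1) :
    ∃ τ ∈ adjPerms (G.induce S), ∃ r ∈ ({ρ, ρ⁻¹} : Finset (Equiv.Perm V)),
      Equiv.Perm.ofSubtype τ * r = σ := by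
  obtain ⟨x, hx⟩ : ∃ x, σ (σ x) ≠ x := by
    by_contra! h
    exact h2 (Equiv.ext fun x => by simpa [pow_two] using h x)
  set r := σ.cycleOf x with hr
  have hmem := huniq _ (isAdjCycle_cycleOf hσ hx)
  have hSr (y : V) : y ∈ S ↔ r y = y := by
    rcases hmem with h | h <;> rw [hS, hr, h]
    rw [Equiv.Perm.inv_eq_iff_eq, eq_comm]
  have hpres (y : V) : σ y ∈ S ↔ y ∈ S := by
    have hcomm : σ (r y) = r (σ y) := by
      simp only [hr, Equiv.Perm.cycleOf_apply, Equiv.Perm.sameCycle_apply_right]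
      split_ifs <;> rfl
    rw [hSr, hSr, ← hcomm, σ.injective.eq_iff]
  have hoff (y : V) (hy : y ∉ S) : r y = σ y := by
    rw [hSr, hr, Equiv.Perm.cycleOf_apply] at hy
    rw [hr, Equiv.Perm.cycleOf_apply]
    split_ifs at hy ⊢ <;> simp_all
  refine ⟨σ.subtypePerm hpres, mem_adjPerms.2 fun y => ?_, r, by simpa using hmem, ?_⟩
  · exact (mem_adjPerms.1 hσ y).imp Subtype.ext id
  · ext y
    rw [Equiv.Perm.mul_apply]
    by_cases hy : y ∈ S
    · rw [(hSr y).1 hy, Equiv.Perm.ofSubtype_apply_of_mem _ hy]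
      rfl
    · rw [hoff y hy, Equiv.Perm.ofSubtype_apply_of_not_mem _ (mt (hpres y).1 hy)]

/-- The permanental and modified characteristic polynomials differ by the permutations using the
unique cycle, in either direction. -/
lemma permPolyG_eq_of_isAdjCycle (hρ : IsAdjCycle G ρ) (h4 : 4 ∣ ρ.support.card)
    (huniq : ∀ τ, IsAdjCycle G τ → τ = ρ ∨ τ = ρ⁻¹) (hS : ∀ x, x ∈ S ↔ ρ x = x) :
    permPolyG ℝ G = phiP G + 4 * phiP (G.induce S) := by
  have hcardS : Fintype.card S = Fintype.card V - ρ.support.card := by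
    rw [← Finset.card_compl, ← Set.toFinset_card]
    congr 1
    ext x
    simp [hS]
  have hphi : phiP (G.induce S) = ∑ τ ∈ adjPerms (G.induce S),
      X ^ (Fintype.card S - (Equiv.Perm.ofSubtype τ).support.card) := by
    rw [phiP_eq_sum_of_sq_eq_one fun τ => sq_eq_one_of_mem_adjPerms_induce huniq hS]
    refine Finset.sum_congr rfl fun τ _ => ?_
    rw [Equiv.Perm.support_ofSubtype, Finset.card_map]
    congr!
  have hdisj (τ : Equiv.Perm S) {r : Equiv.Perm V}
      (hr : r ∈ ({ρ, ρ⁻¹} : Finset (Equiv.Perm V))) : (Equiv.Perm.ofSubtype τ).Disjoint r := by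
    rw [Finset.mem_insert, Finset.mem_singleton] at hr
    rcases hr with rfl | rfl
    · exact disjoint_ofSubtype hS τ
    · exact (disjoint_ofSubtype hS τ).inv_right
  have hcyc {r : Equiv.Perm V} (hr : r ∈ ({ρ, ρ⁻¹} : Finset (Equiv.Perm V))) :
      IsAdjCycle G r ∧ r.support.card = ρ.support.card := by
    rw [Finset.mem_insert, Finset.mem_singleton] at hr
    rcases hr with rfl | rfl
    · exact ⟨hρ, rfl⟩
    · exact ⟨hρ.inv, by rw [Equiv.Perm.support_inv]⟩
  rw [← sub_eq_iff_eq_add', permPolyG_eq_sum, phiP_eq_sum, ← Finset.sum_sub_distrib, hphi]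
  symm
  calc (4 : ℝ[X]) * ∑ τ ∈ adjPerms (G.induce S),
        X ^ (Fintype.card S - (Equiv.Perm.ofSubtype τ).support.card)
      = ∑ p ∈ adjPerms (G.induce S) ×ˢ ({ρ, ρ⁻¹} : Finset (Equiv.Perm V)),
          2 * X ^ (Fintype.card S - (Equiv.Perm.ofSubtype p.1).support.card) := by
        rw [Finset.sum_product, Finset.mul_sum]
        refine Finset.sum_congr rfl fun τ _ => ?_
        dsimp only
        rw [Finset.sum_const, Finset.card_pair hρ.ne_inv, nsmul_eq_mul]
        push_cast
        ring
    _ = ∑ σ ∈ adjPerms G with σ ^ 2 ≠ 1,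
          ((-1) ^ σ.support.card * X ^ (Fintype.card V - σ.support.card) -
            if Even σ.support.card then
              C ((-1) ^ (σ.support.card / 2) * ((Equiv.Perm.sign σ : ℤ) : ℝ)) *
                X ^ (Fintype.card V - σ.support.card)
            else 0) := by
        refine Finset.sum_bij (fun p _ => Equiv.Perm.ofSubtype p.1 * p.2) ?_ ?_ ?_ ?_
        · rintro ⟨τ, r⟩ hp
          obtain ⟨hτ, hr⟩ := Finset.mem_product.1 hp
          obtain ⟨hr', -⟩ := hcyc hr
          have hd := hdisj τ hr
          refine Finset.mem_filter.2
            ⟨mul_mem_adjPerms_of_disjoint (ofSubtype_mem_adjPerms hτ) hr'.mem hd, fun h => ?_⟩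
          rw [hd.commute.mul_pow] at h
          exact hr'.sq_ne_one (((hd.pow_disjoint_pow 2 2).mul_eq_one_iff.1 h).2)
        · rintro ⟨τ, r⟩ hp ⟨τ', r'⟩ hp' h
          obtain ⟨rfl, rfl⟩ := eq_and_eq_of_ofSubtype_mul_eq hS
            (by simpa using (Finset.mem_product.1 hp).2)
            (by simpa using (Finset.mem_product.1 hp').2) h
          rfl
        · intro σ hσ
          obtain ⟨hσ, h2⟩ := Finset.mem_filter.1 hσ
          obtain ⟨τ, hτ, r, hr, h⟩ := exists_eq_ofSubtype_mul huniq hS hσ h2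
          exact ⟨(τ, r), Finset.mem_product.2 ⟨hτ, hr⟩, h⟩
        · rintro ⟨τ, r⟩ hp
          obtain ⟨hτ, hr⟩ := Finset.mem_product.1 hp
          obtain ⟨hr', hrc⟩ := hcyc hr
          have hd := hdisj τ hr
          have hsq : Equiv.Perm.ofSubtype τ ^ 2 = 1 := by
            rw [← map_pow, sq_eq_one_of_mem_adjPerms_induce huniq hS hτ, map_one]
          obtain ⟨⟨m, hm⟩, hsign⟩ := even_card_support_and_sign_of_sq_eq_one hsq
          obtain ⟨k, hk⟩ := h4
          have hcard : (Equiv.Perm.ofSubtype τ * r).support.card = 2 * (m + 2 * k) := by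
            rw [hd.card_support_mul, hrc]
            omega
          have hsgn : Equiv.Perm.sign (Equiv.Perm.ofSubtype τ * r) = -(-1) ^ m := by
            rw [Equiv.Perm.sign_mul, hsign, hr'.isCycle.sign, hrc,
              (show Even ρ.support.card from ⟨2 * k, by omega⟩).neg_one_pow,
              show (Equiv.Perm.ofSubtype τ).support.card / 2 = m by omega, mul_neg,
              mul_one]
          have hexp : Fintype.card S - (Equiv.Perm.ofSubtype τ).support.card =
              Fintype.card V - 2 * (m + 2 * k) := by omega
          have hone : (-1 : ℝ) ^ (m + 2 * k) * -(-1) ^ m = -1 := by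
            rw [pow_add, pow_mul, mul_neg, mul_right_comm, ← mul_pow]
            simp
          dsimp only
          rw [hcard, hsgn, if_pos (even_two_mul _), (even_two_mul _).neg_one_pow,
            Nat.mul_div_cancel_left _ two_pos, hexp]
          push_cast
          rw [hone]
          simp only [map_neg, map_one]
          ring
    _ = _ := by
        refine Finset.sum_filter_of_ne fun σ _ hne h2 => hne ?_
        obtain ⟨he, hs⟩ := even_card_support_and_sign_of_sq_eq_one h2
        rw [if_pos he, hs, he.neg_one_pow]
        push_cast
        rw [← mul_pow]
        simp

end Unicyclic

/-- Let `G` be a unicyclic bipartite graph whose unique cycle `R` has length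
divisible by 4. Then `π(G,x) = φ_p(G,x) + 4·φ_p(G∖R, x)`. -/
theorem stmt_14 {V : Type*} [Fintype V] (G : SimpleGraph V) (hbip : G.Colorable 2)
    (hconn : G.Connected)
    (v : V) (c : G.Walk v v) (hc : c.IsCycle) (h4 : 4 ∣ c.length)
    (huniq : ∀ R : G.Subgraph, IsCycleSubgraph G R → R = c.toSubgraph) :
    permPolyG ℝ G = phiP G + 4 * phiP (G.induce (c.toSubgraph.vertsᶜ)) := by
  obtain ⟨ρ, hρ, hsupp, hcard⟩ := exists_isAdjCycle_of_isCycle hc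
  have hadj (τ : Equiv.Perm V) (hτ : IsAdjCycle G τ) (x y : V) :
      c.toSubgraph.Adj x y ↔ τ x ≠ x ∧ (τ x = y ∨ τ y = x) := by
    obtain ⟨u, w, hw, h⟩ := hτ.exists_walk
    rw [← huniq _ ⟨u, w, hw, rfl⟩, h]
  refine permPolyG_eq_of_isAdjCycle hρ (hcard ▸ h4)
    (fun τ hτ => hτ.eq_or_eq_inv hρ fun x y => (hadj τ hτ x y).symm.trans (hadj ρ hρ x y))
    fun x => ?_
  rw [Set.mem_compl_iff, SimpleGraph.Walk.mem_verts_toSubgraph, ← List.mem_toFinset, ← hsupp,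
    Equiv.Perm.notMem_support]

end
end
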